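/- For any 3-MIPPC(2,M,q), the size M satisfies M³ − 2qM² + 2q²M − q⁴ ≤ 0. -/

import Mathlib

/-- The descendant code of a sub-code of a code of length 2, viewed as a set of pairs. -/
def desc2 {q : ℕ} (C' : Finset (Fin q × Fin q)) : Set (Fin q × Fin q) :=
  {x | (∃ c ∈ C', c.1 = x.1) ∧ (∃ c ∈ C', c.2 = x.2)}

/-- `C` is a `t`-MIPPC of length 2: for every descendant set produced by some nonempty
sub-code of size at most `t`, all such parent sets have a common codeword. -/
def isMIPPC2 {q : ℕ} (t : ℕ) (C : Finset (Fin q × Fin q)) : Prop :=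
  ∀ S : Set (Fin q × Fin q),
    (∃ C' : Finset (Fin q × Fin q), C' ⊆ C ∧ C'.Nonempty ∧ C'.card ≤ t ∧ desc2 C' = S) →
    ∃ c, ∀ C' : Finset (Fin q × Fin q),
      C' ⊆ C → C'.Nonempty → C'.card ≤ t → desc2 C' = S → c ∈ C'

/-- `A¹_a = {b : (a,b) ∈ C}`. -/
def A1 {q : ℕ} (C : Finset (Fin q × Fin q)) (a : Fin q) : Finset (Fin q) :=
  (C.filter (fun c => c.1 = a)).image Prod.snd

/-- Condition (I). -/
def CondI {q : ℕ} (C : Finset (Fin q × Fin q)) : Prop :=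
  ∀ a₁ a₂ : Fin q, a₁ ≠ a₂ → (A1 C a₁ ∩ A1 C a₂).card ≤ 1

/-- Condition (II). -/
def CondII {q : ℕ} (C : Finset (Fin q × Fin q)) : Prop :=
  ¬ ∃ a₁ a₂ a₃ b₁ b₂ b₃ : Fin q,
      a₁ ≠ a₂ ∧ a₁ ≠ a₃ ∧ a₂ ≠ a₃ ∧ b₁ ≠ b₂ ∧ b₁ ≠ b₃ ∧ b₂ ≠ b₃ ∧
      b₁ ∈ A1 C a₁ ∧ b₂ ∈ A1 C a₁ ∧ b₂ ∈ A1 C a₂ ∧ b₃ ∈ A1 C a₂ ∧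
      b₁ ∈ A1 C a₃ ∧ b₃ ∈ A1 C a₃

section

variable {q : ℕ} {C : Finset (Fin q × Fin q)}

/-- A 3-MIPPC of length 2 contains no 4-cycle. -/
lemma isMIPPC2.no_four_cycle (hC : isMIPPC2 3 C) {a₁ a₂ b₁ b₂ : Fin q} (ha : a₁ ≠ a₂)
    (hb : b₁ ≠ b₂) (h₁₁ : (a₁, b₁) ∈ C) (h₂₂ : (a₂, b₂) ∈ C) (h₁₂ : (a₁, b₂) ∈ C)
    (h₂₁ : (a₂, b₁) ∈ C) : False := by
  obtain ⟨c, hc⟩ := hC (desc2 {(a₁, b₁), (a₂, b₂)})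
    ⟨{(a₁, b₁), (a₂, b₂)}, by simp [Finset.insert_subset_iff, *], by simp,
      Finset.card_le_two.trans (by norm_num), rfl⟩
  have hm₁ := hc {(a₁, b₁), (a₂, b₂)} (by simp [Finset.insert_subset_iff, *]) (by simp)
    (Finset.card_le_two.trans (by norm_num)) rfl
  have hm₂ := hc {(a₁, b₂), (a₂, b₁)} (by simp [Finset.insert_subset_iff, *]) (by simp)
    (Finset.card_le_two.trans (by norm_num)) (by ext x; simp [desc2]; tauto)
  simp only [Finset.mem_insert, Finset.mem_singleton] at hm₁ hm₂
  grind

/-- A 3-MIPPC of length 2 contains no 6-cycle. -/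
lemma isMIPPC2.no_six_cycle (hC : isMIPPC2 3 C) {a₁ a₂ a₃ b₁ b₂ b₃ : Fin q}
    (ha₁₂ : a₁ ≠ a₂) (ha₁₃ : a₁ ≠ a₃) (ha₂₃ : a₂ ≠ a₃)
    (hb₁₂ : b₁ ≠ b₂) (hb₁₃ : b₁ ≠ b₃) (hb₂₃ : b₂ ≠ b₃)
    (h₁₁ : (a₁, b₁) ∈ C) (h₂₂ : (a₂, b₂) ∈ C) (h₃₃ : (a₃, b₃) ∈ C)
    (h₁₂ : (a₁, b₂) ∈ C) (h₂₃ : (a₂, b₃) ∈ C) (h₃₁ : (a₃, b₁) ∈ C) : False := by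
  obtain ⟨c, hc⟩ := hC (desc2 {(a₁, b₁), (a₂, b₂), (a₃, b₃)})
    ⟨{(a₁, b₁), (a₂, b₂), (a₃, b₃)}, by simp [Finset.insert_subset_iff, *], by simp,
      Finset.card_le_three, rfl⟩
  have hm₁ := hc {(a₁, b₁), (a₂, b₂), (a₃, b₃)} (by simp [Finset.insert_subset_iff, *])
    (by simp) Finset.card_le_three rfl
  have hm₂ := hc {(a₁, b₂), (a₂, b₃), (a₃, b₁)} (by simp [Finset.insert_subset_iff, *])
    (by simp) Finset.card_le_three (by ext x; simp [desc2]; tauto)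
  simp only [Finset.mem_insert, Finset.mem_singleton] at hm₁ hm₂
  grind

/-- The neighbours in the second coordinate of a first coordinate `a`. -/
def rowNbrs (C : Finset (Fin q × Fin q)) (a : Fin q) : Finset (Fin q) :=
  Finset.univ.filter fun b => (a, b) ∈ C

/-- The neighbours in the first coordinate of a second coordinate `b`. -/
def colNbrs (C : Finset (Fin q × Fin q)) (b : Fin q) : Finset (Fin q) :=
  Finset.univ.filter fun a => (a, b) ∈ C

/-- Two vertices on opposite sides of a bipartite graph without cycles of length 4 or 6 are
joined by at most one path of length 1 or 3. -/
lemma isMIPPC2.card_add_sum_le (hC : isMIPPC2 3 C) :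
    C.card + ∑ c ∈ C, ((colNbrs C c.2).card - 1) * ((rowNbrs C c.1).card - 1) ≤ q ^ 2 := by
  classical
  let T : Fin q × Fin q → Finset (Fin q × Fin q) := fun c =>
    (colNbrs C c.2).erase c.1 ×ˢ (rowNbrs C c.1).erase c.2
  have hT : ∀ c x, x ∈ T c ↔
      (x.1 ≠ c.1 ∧ (x.1, c.2) ∈ C) ∧ (x.2 ≠ c.2 ∧ (c.1, x.2) ∈ C) := by
    simp [T, rowNbrs, colNbrs]
  have hcard : ∀ c ∈ C,
      (T c).card = ((colNbrs C c.2).card - 1) * ((rowNbrs C c.1).card - 1) := by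
    intro c hc
    rw [Finset.card_product, Finset.card_erase_of_mem (by simpa [colNbrs] using hc),
      Finset.card_erase_of_mem (by simpa [rowNbrs] using hc)]
  have hdisj : (C : Set (Fin q × Fin q)).PairwiseDisjoint T := by
    rintro ⟨a, b⟩ hab ⟨a', b'⟩ hab' hne
    refine Finset.disjoint_left.2 ?_
    rintro ⟨x, y⟩ hx hx'
    obtain ⟨⟨h1, h2⟩, h3, h4⟩ := (hT _ _).1 hx
    obtain ⟨⟨h1', h2'⟩, h3', h4'⟩ := (hT _ _).1 hx'
    simp only [Finset.mem_coe] at *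
    by_cases ha : a = a'
    · subst ha
      have hb : b ≠ b' := fun h => hne (by rw [h])
      exact hC.no_four_cycle h1 hb h2 hab' h2' hab
    · by_cases hb : b = b'
      · subst hb
        exact hC.no_four_cycle ha h3 h4 hab' hab h4'
      · exact hC.no_six_cycle (Ne.symm ha) h1'.symm h1.symm
          h3'.symm (Ne.symm hb) h3 hab' h4 h2 h4' hab h2'
  have hdisjC : Disjoint C (C.biUnion T) := by
    refine Finset.disjoint_left.2 ?_
    rintro ⟨x, y⟩ hxy hx
    obtain ⟨⟨a, b⟩, hab, hx⟩ := Finset.mem_biUnion.1 hx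
    obtain ⟨⟨h1, h2⟩, h3, h4⟩ := (hT _ _).1 hx
    exact hC.no_four_cycle h1 h3 hxy hab h2 h4
  rw [← Finset.sum_congr rfl hcard, ← Finset.card_biUnion hdisj,
    ← Finset.card_union_of_disjoint hdisjC]
  exact (Finset.card_le_univ _).trans (by simp [sq])

lemma sum_inv_card_rowNbrs_le (C : Finset (Fin q × Fin q)) :
    ∑ c ∈ C, ((rowNbrs C c.1).card : ℝ)⁻¹ ≤ q := by
  have h : ∑ c ∈ C, ((rowNbrs C c.1).card : ℝ)⁻¹ =
      ∑ a : Fin q, ∑ _b ∈ rowNbrs C a, ((rowNbrs C a).card : ℝ)⁻¹ :=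
    Finset.sum_finset_product' C Finset.univ (rowNbrs C) (by simp [rowNbrs])
      (f := fun a _ => ((rowNbrs C a).card : ℝ)⁻¹)
  rw [h]
  simp only [Finset.sum_const, nsmul_eq_mul]
  exact (Finset.sum_le_sum fun a _ => mul_inv_le_one).trans (by simp)

lemma sum_inv_card_colNbrs_le (C : Finset (Fin q × Fin q)) :
    ∑ c ∈ C, ((colNbrs C c.2).card : ℝ)⁻¹ ≤ q := by
  have h : ∑ c ∈ C, ((colNbrs C c.2).card : ℝ)⁻¹ =
      ∑ b : Fin q, ∑ _a ∈ colNbrs C b, ((colNbrs C b).card : ℝ)⁻¹ :=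
    Finset.sum_finset_product_right' C Finset.univ (colNbrs C) (by simp [colNbrs])
      (f := fun _ b => ((colNbrs C b).card : ℝ)⁻¹)
  rw [h]
  simp only [Finset.sum_const, nsmul_eq_mul]
  exact (Finset.sum_le_sum fun a _ => mul_inv_le_one).trans (by simp)

/-- A separable lower bound for `(x - 1) * (y - 1)` on vertex degrees bounds the number of
edges. -/
lemma isMIPPC2.card_mul_le (hC : isMIPPC2 3 C) {α β : ℝ} (hβ : 0 ≤ β)
    (h : ∀ x y : ℕ, 1 ≤ x → 1 ≤ y → x ≤ q → y ≤ q →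
      (α * (x * y) : ℝ) ≤ x * y * ((x - 1) * (y - 1)) + β * (x + y)) :
    C.card * (1 + α) ≤ (q : ℝ) ^ 2 + 2 * β * q := by
  have key : ∀ c ∈ C, α - β * ((colNbrs C c.2).card : ℝ)⁻¹ - β * ((rowNbrs C c.1).card : ℝ)⁻¹ ≤
      (((colNbrs C c.2).card - 1) * ((rowNbrs C c.1).card - 1) : ℕ) := by
    intro c hc
    have hx : 1 ≤ (colNbrs C c.2).card :=
      Finset.card_pos.2 ⟨c.1, by simpa [colNbrs] using hc⟩
    have hy : 1 ≤ (rowNbrs C c.1).card :=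
      Finset.card_pos.2 ⟨c.2, by simpa [rowNbrs] using hc⟩
    have hx' : (colNbrs C c.2).card ≤ q := (Finset.card_le_univ _).trans (by simp)
    have hy' : (rowNbrs C c.1).card ≤ q := (Finset.card_le_univ _).trans (by simp)
    generalize (colNbrs C c.2).card = x at *
    generalize (rowNbrs C c.1).card = y at *
    have hxy := h x y hx hy hx' hy'
    push_cast [hx, hy]
    have hx0 : (0 : ℝ) < x := by exact_mod_cast hx
    have hy0 : (0 : ℝ) < y := by exact_mod_cast hy
    refine le_of_mul_le_mul_left ?_ (mul_pos hx0 hy0)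
    have e : (x * y : ℝ) * (α - β * (x : ℝ)⁻¹ - β * (y : ℝ)⁻¹) = α * (x * y) - β * (x + y) := by
      field_simp
      ring
    linarith
  have hsum := Finset.sum_le_sum key
  simp only [Finset.sum_sub_distrib, ← Finset.mul_sum, Finset.sum_const, nsmul_eq_mul,
    ← Nat.cast_sum] at hsum
  have hcard : (C.card : ℝ) +
      (∑ c ∈ C, ((colNbrs C c.2).card - 1) * ((rowNbrs C c.1).card - 1) : ℕ) ≤ (q : ℝ) ^ 2 := by
    exact_mod_cast hC.card_add_sum_le
  have h1 := mul_le_mul_of_nonneg_left (sum_inv_card_rowNbrs_le C) hβ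
  have h2 := mul_le_mul_of_nonneg_left (sum_inv_card_colNbrs_le C) hβ
  linarith

end

/-- Supporting inequality for `(x - 1) * (y - 1)` at `x = y = c + 1`, after clearing
denominators. -/
lemma support_mul_sub_one {x y c : ℝ} (hx : 1 ≤ x) (hy : 1 ≤ y) (hc : 0 ≤ c)
    (hc' : c + 1 ≤ c ^ 2) :
    (3 * c ^ 2 + 2 * c) * (x * y) ≤
      x * y * ((x - 1) * (y - 1)) + c * (c + 1) ^ 2 * (x + y) := by
  have hm : 0 ≤ x * y := by positivity
  rcases le_total (x * y) (c * (c + 1) ^ 2) with h | h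
  · obtain ⟨t, ht, htm⟩ : ∃ t : ℝ, 0 ≤ t ∧ t ^ 2 = x * y :=
      ⟨√(x * y), Real.sqrt_nonneg _, Real.sq_sqrt hm⟩
    have hs : 2 * t ≤ x + y := by
      apply le_of_sq_le_sq _ (by linarith)
      nlinarith [sq_nonneg (x - y)]
    have h1 := mul_nonneg (sub_nonneg.2 hs) (sub_nonneg.2 h)
    have h2 : 0 ≤ t * ((t - (c + 1)) ^ 2 * (t + 2 * c)) := by positivity
    rw [← htm] at h1
    have e : x * y * ((x - 1) * (y - 1)) = t ^ 2 * (t ^ 2 - (x + y) + 1) := by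
      rw [htm]; ring
    rw [e, ← htm]
    linarith
  · have h1 := mul_nonneg (mul_nonneg (sub_nonneg.2 hx) (sub_nonneg.2 hy)) (sub_nonneg.2 h)
    have h2 : 0 ≤ x * y * (c * (c ^ 2 - (c + 1))) :=
      mul_nonneg hm (mul_nonneg hc (sub_nonneg.2 hc'))
    have h3 : 0 ≤ c * (c + 1) ^ 2 := by positivity
    linarith

/-- Size bound for a 3-MIPPC(2,M,q): `M³ − 2qM² + 2q²M − q⁴ ≤ 0`. -/
theorem mippc3_cubic_bound {q : ℕ} (C : Finset (Fin q × Fin q)) (hC : isMIPPC2 3 C) :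
    (C.card : ℤ) ^ 3 - 2 * q * (C.card : ℤ) ^ 2 + 2 * (q : ℤ) ^ 2 * C.card
      - (q : ℤ) ^ 4 ≤ 0 := by
  rcases Nat.lt_or_ge q 10 with hq | hq
  · have hsmall : q ≤ 6 → C.card * (q + 2) ≤ 3 * q ^ 2 := by
      intro hq6
      have h := hC.card_mul_le (α := q + 1) (β := q) (by positivity) (by
        intro x y hx hy hxq hyq
        have hint : ((q + 1) * (x * y) : ℤ) ≤ x * y * ((x - 1) * (y - 1)) + q * (x + y) := by
          interval_cases q <;> interval_cases x <;> interval_cases y <;> norm_num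
        exact_mod_cast hint)
      have h' : (C.card * (q + 2) : ℝ) ≤ 3 * q ^ 2 := by linarith
      exact_mod_cast h'
    have hmid : C.card * 13 ≤ q ^ 2 + 24 * q := by
      have h := hC.card_mul_le (α := 12) (β := 12) (by positivity) (by
        intro x y hx hy hxq hyq
        have hint : (12 * (x * y) : ℤ) ≤ x * y * ((x - 1) * (y - 1)) + 12 * (x + y) := by
          have hx9 : x ≤ 9 := by omega
          have hy9 : y ≤ 9 := by omega
          clear hxq hyq
          interval_cases x <;> interval_cases y <;> norm_num
        exact_mod_cast hint)
      have h' : (C.card * 13 : ℝ) ≤ q ^ 2 + 24 * q := by linarith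
      exact_mod_cast h'
    generalize C.card = e at *
    have he : e ≤ 22 := by nlinarith
    clear hC
    interval_cases q <;> interval_cases e <;> norm_num at *
  · by_contra! hlt
    have hltR : (0 : ℝ) < (C.card : ℝ) ^ 3 - 2 * q * (C.card : ℝ) ^ 2 +
        2 * (q : ℝ) ^ 2 * C.card - (q : ℝ) ^ 4 := by exact_mod_cast hlt
    have hqR : (10 : ℝ) ≤ q := by exact_mod_cast hq
    have hq0 : (0 : ℝ) < q := by linarith
    obtain ⟨c, hc⟩ : ∃ c : ℝ, (C.card : ℝ) = (c + 1) * q :=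
      ⟨C.card / q - 1, by field_simp; ring⟩
    have hc1 : 0 ≤ c + 1 :=
      nonneg_of_mul_nonneg_left (hc ▸ Nat.cast_nonneg _) hq0
    have hD : (q : ℝ) < (c + 1) * (c ^ 2 + 1) := by
      refine lt_of_mul_lt_mul_left ?_ (pow_pos hq0 3).le
      rw [hc] at hltR
      linarith
    have hc0 : 3 / 2 ≤ c := by
      by_contra! h
      nlinarith [mul_nonneg hc1 (sub_nonneg.2 h.le), mul_nonneg hc1 hc1]
    have hcc : c + 1 ≤ c ^ 2 := by
      by_contra! h
      nlinarith
    have h := hC.card_mul_le (α := 3 * c ^ 2 + 2 * c) (β := c * (c + 1) ^ 2) (by positivity)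
      fun x y hx hy _ _ => support_mul_sub_one (by exact_mod_cast hx) (by exact_mod_cast hy)
        (by linarith) hcc
    rw [hc] at h
    have := mul_lt_mul_of_pos_left hD hq0
    linarith
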